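/- arXiv:2410.04136 — 3 statements merged into one kernel-verified Lean document; each statement's English description precedes it below -/
import Mathlib

section
/- Let k be even, let (c_1,…,c_k) be a P-admissible finite tuple, and set x_0 = Inf^{P⁻}(c_1…c_k). For each n ≥ 1 let d^{(n)} be a P-admissible sequence with x_n = val_{P⁻}(d^{(n)}) satisfying x_0 < x_n < 1. Then x_n → x_0 if and only if there exists n_0 such that: (i) for all n ≥ n_0 and all i ≤ k one has d^{(n)}_i = c_i, and (ii) d^{(n)}_{k+1} → ∞ as n → ∞. -/
open Filter Finset Topology

/-! `φ` encodes the family of functions: `φ []` is `φ₀` and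
`φ [c₁, …, cₙ]` is `φₙ(c₁, …, cₙ)`. Sequences are 0-indexed:
`p 0` is the paper's `p₁`. -/

/-- The list of the first `n` terms of the sequence `p`. -/
def prefixList (p : ℕ → ℕ) (n : ℕ) : List ℕ :=
  List.ofFn (fun i : Fin n => p i)

/-- A sequence `p` is `P`-admissible if `pₙ ≥ r_{n-1} + 1` for all `n ≥ 1`. -/
def PAdmissibleSeq (φ : List ℕ → ℕ) (p : ℕ → ℕ) : Prop :=
  ∀ n : ℕ, φ (prefixList p n) + 1 ≤ p n

/-- A tuple `(c₁, …, c_k)` (given as the first `k` values of `c`) is `P`-admissible. -/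
def PAdmissibleTuple (φ : List ℕ → ℕ) (c : ℕ → ℕ) (k : ℕ) : Prop :=
  ∀ n < k, φ (prefixList c n) + 1 ≤ c n

/-- `r₀ r₁ ⋯ rₙ` where `rᵢ = φᵢ(p₁, …, pᵢ)`. -/
noncomputable def numer (φ : List ℕ → ℕ) (p : ℕ → ℕ) (n : ℕ) : ℝ :=
  ∏ i ∈ Finset.range (n + 1), (φ (prefixList p i) : ℝ)

/-- `(p₁ − 1)p₁ ⋯ (pₙ − 1)pₙ`. -/
noncomputable def denomBase (p : ℕ → ℕ) (n : ℕ) : ℝ :=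
  ∏ j ∈ Finset.range n, (((p j : ℝ) - 1) * (p j : ℝ))

/-- The `P`-value `val_P(p) = Σ_{n=0}^∞ (r₀⋯rₙ)/((p₁−1)p₁⋯(pₙ−1)pₙ·p_{n+1})`. -/
noncomputable def valP (φ : List ℕ → ℕ) (p : ℕ → ℕ) : ℝ :=
  ∑' n : ℕ, numer φ p n / (denomBase p n * (p n : ℝ))

/-- The `P⁻`-value
`val_{P⁻}(q) = Σ_{n=0}^∞ (−1)ⁿ (r₀⋯rₙ)/((q₁−1)q₁⋯(qₙ−1)qₙ·(q_{n+1}−1))`. -/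
noncomputable def valPNeg (φ : List ℕ → ℕ) (q : ℕ → ℕ) : ℝ :=
  ∑' n : ℕ, (-1 : ℝ) ^ n * numer φ q n / (denomBase q n * ((q n : ℝ) - 1))

/-- `Inf^P(c₁…c_k) = Σ_{n=0}^{k−1} (r₀⋯rₙ)/((c₁−1)c₁⋯(cₙ−1)cₙ·c_{n+1})`. -/
noncomputable def InfP (φ : List ℕ → ℕ) (c : ℕ → ℕ) (k : ℕ) : ℝ :=
  ∑ n ∈ Finset.range k, numer φ c n / (denomBase c n * (c n : ℝ))

/-- The diameter `(r₀⋯r_{k−1})/((c₁−1)c₁⋯(c_k−1)c_k)`. -/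
noncomputable def DiamP (φ : List ℕ → ℕ) (c : ℕ → ℕ) (k : ℕ) : ℝ :=
  (∏ i ∈ Finset.range k, (φ (prefixList c i) : ℝ)) / denomBase c k

/-- `Sup^P(c₁…c_k) = Inf^P(c₁…c_k) + (r₀⋯r_{k−1})/((c₁−1)c₁⋯(c_k−1)c_k)`. -/
noncomputable def SupP (φ : List ℕ → ℕ) (c : ℕ → ℕ) (k : ℕ) : ℝ :=
  InfP φ c k + DiamP φ c k

/-- `A(c₁…c_k) = Σ_{n=0}^{k−1} (−1)ⁿ (r₀⋯rₙ)/((c₁−1)c₁⋯(cₙ−1)cₙ·(c_{n+1}−1))`. -/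
noncomputable def APNeg (φ : List ℕ → ℕ) (c : ℕ → ℕ) (k : ℕ) : ℝ :=
  ∑ n ∈ Finset.range k, (-1 : ℝ) ^ n * numer φ c n / (denomBase c n * ((c n : ℝ) - 1))

/-- `Sup^{P⁻}(c₁…c_k)`: `A` if `k` odd, `A + D` if `k` even. -/
noncomputable def SupPNeg (φ : List ℕ → ℕ) (c : ℕ → ℕ) (k : ℕ) : ℝ :=
  if Odd k then APNeg φ c k else APNeg φ c k + DiamP φ c k

/-- `Inf^{P⁻}(c₁…c_k)`: `A − D` if `k` odd, `A` if `k` even. -/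
noncomputable def InfPNeg (φ : List ℕ → ℕ) (c : ℕ → ℕ) (k : ℕ) : ℝ :=
  if Odd k then APNeg φ c k - DiamP φ c k else APNeg φ c k

lemma prefixList_succ (q : ℕ → ℕ) (n : ℕ) :
    prefixList q (n + 1) = q 0 :: prefixList (fun i => q (i + 1)) n := by
  simp [prefixList, List.ofFn_succ]

lemma numer_succ (φ : List ℕ → ℕ) (q : ℕ → ℕ) (n : ℕ) :
    numer φ q (n + 1) = φ [] * numer (fun l => φ (q 0 :: l)) (fun i => q (i + 1)) n := by
  rw [numer, Finset.prod_range_succ', mul_comm, numer]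
  simp only [prefixList_succ]
  rfl

lemma denomBase_succ (q : ℕ → ℕ) (n : ℕ) :
    denomBase q (n + 1) = ((q 0 : ℝ) - 1) * q 0 * denomBase (fun i => q (i + 1)) n := by
  rw [denomBase, Finset.prod_range_succ', mul_comm, denomBase]

/-- The `n`-th term of the series defining `valPNeg`. -/
noncomputable def termPNeg (φ : List ℕ → ℕ) (q : ℕ → ℕ) (n : ℕ) : ℝ :=
  (-1 : ℝ) ^ n * numer φ q n / (denomBase q n * ((q n : ℝ) - 1))

lemma termPNeg_zero (φ : List ℕ → ℕ) (q : ℕ → ℕ) :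
    termPNeg φ q 0 = φ [] / ((q 0 : ℝ) - 1) := by
  simp [termPNeg, numer, denomBase, prefixList]

lemma termPNeg_succ (φ : List ℕ → ℕ) (q : ℕ → ℕ) (n : ℕ) :
    termPNeg φ q (n + 1) = -(φ [] / (((q 0 : ℝ) - 1) * q 0)) *
      termPNeg (fun l => φ (q 0 :: l)) (fun i => q (i + 1)) n := by
  rw [termPNeg, termPNeg, numer_succ, denomBase_succ, pow_succ]
  simp only [div_eq_mul_inv, mul_inv]
  ring

/-- The map sending the value of the tail of a sequence with first term `a` to the value of the
whole sequence, where `r = φ []`. -/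
noncomputable def consPNeg (r a : ℕ) (s : ℝ) : ℝ :=
  r / ((a : ℝ) - 1) - r / (((a : ℝ) - 1) * a) * s

/-- The map sending the value of the tail after the first `k` terms of `c` to the value of the
whole sequence. -/
noncomputable def appendPNeg (φ : List ℕ → ℕ) (c : ℕ → ℕ) (k : ℕ) (t : ℝ) : ℝ :=
  APNeg φ c k + (-1) ^ k * DiamP φ c k * t

lemma appendPNeg_zero (φ : List ℕ → ℕ) (c : ℕ → ℕ) (t : ℝ) : appendPNeg φ c 0 t = t := by
  simp [appendPNeg, APNeg, DiamP, denomBase]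

lemma appendPNeg_succ (φ : List ℕ → ℕ) (c : ℕ → ℕ) (k : ℕ) (t : ℝ) :
    appendPNeg φ c (k + 1) t = consPNeg (φ []) (c 0)
      (appendPNeg (fun l => φ (c 0 :: l)) (fun i => c (i + 1)) k t) := by
  have hA : APNeg φ c (k + 1) = φ [] / ((c 0 : ℝ) - 1) - φ [] / (((c 0 : ℝ) - 1) * c 0) *
      APNeg (fun l => φ (c 0 :: l)) (fun i => c (i + 1)) k := by
    change ∑ n ∈ Finset.range (k + 1), termPNeg φ c n = _ - _ *
      ∑ n ∈ Finset.range k, termPNeg (fun l => φ (c 0 :: l)) (fun i => c (i + 1)) n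
    rw [Finset.sum_range_succ', termPNeg_zero]
    simp only [termPNeg_succ, ← Finset.mul_sum]
    ring
  have hD : DiamP φ c (k + 1) = φ [] / (((c 0 : ℝ) - 1) * c 0) *
      DiamP (fun l => φ (c 0 :: l)) (fun i => c (i + 1)) k := by
    rw [DiamP, DiamP, denomBase_succ, Finset.prod_range_succ']
    simp only [prefixList_succ]
    rw [mul_comm, mul_div_mul_comm]
    rfl
  rw [appendPNeg, hA, hD, consPNeg, appendPNeg, pow_succ]
  ring

lemma PAdmissibleSeq.first {φ : List ℕ → ℕ} {q : ℕ → ℕ} (h : PAdmissibleSeq φ q) :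
    φ [] + 1 ≤ q 0 := h 0

lemma PAdmissibleSeq.tail {φ : List ℕ → ℕ} {q : ℕ → ℕ} (h : PAdmissibleSeq φ q) :
    PAdmissibleSeq (fun l => φ (q 0 :: l)) (fun i => q (i + 1)) := fun n => by
  simpa only [prefixList_succ] using h (n + 1)

lemma PAdmissibleTuple.first {φ : List ℕ → ℕ} {c : ℕ → ℕ} {k : ℕ}
    (h : PAdmissibleTuple φ c (k + 1)) : φ [] + 1 ≤ c 0 := h 0 k.succ_pos

lemma PAdmissibleTuple.tail {φ : List ℕ → ℕ} {c : ℕ → ℕ} {k : ℕ}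
    (h : PAdmissibleTuple φ c (k + 1)) :
    PAdmissibleTuple (fun l => φ (c 0 :: l)) (fun i => c (i + 1)) k := fun n hn => by
  simpa only [prefixList_succ] using h (n + 1) (by omega)

lemma consPNeg_eq {r a : ℕ} (hr : 0 < r) (ha : r + 1 ≤ a) (s : ℝ) :
    consPNeg r a s = r / a + r / (((a : ℝ) - 1) * a) * (1 - s) := by
  have h1 : (r : ℝ) + 1 ≤ a := by exact_mod_cast ha
  have h0 : (0 : ℝ) < r := by exact_mod_cast hr
  have h2 : (a : ℝ) - 1 ≠ 0 := by linarith
  have h3 : (a : ℝ) ≠ 0 := by linarith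
  rw [consPNeg]
  field_simp
  ring

lemma consPNeg_coeff_pos {r a : ℕ} (hr : 0 < r) (ha : r + 1 ≤ a) :
    0 < (r : ℝ) / (((a : ℝ) - 1) * a) := by
  have h1 : (r : ℝ) + 1 ≤ a := by exact_mod_cast ha
  have h0 : (0 : ℝ) < r := by exact_mod_cast hr
  have h2 : 0 < (a : ℝ) - 1 := by linarith
  have h3 : 0 < (a : ℝ) := by linarith
  positivity

lemma div_sub_one_le_one {r a : ℕ} (hr : 0 < r) (ha : r + 1 ≤ a) :
    (r : ℝ) / ((a : ℝ) - 1) ≤ 1 := by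
  have h1 : (r : ℝ) + 1 ≤ a := by exact_mod_cast ha
  have h0 : (0 : ℝ) < r := by exact_mod_cast hr
  rw [div_le_one (by linarith)]
  linarith

lemma consPNeg_mem_Ioo {r a : ℕ} (hr : 0 < r) (ha : r + 1 ≤ a) {s : ℝ} (hs : s ∈ Set.Ioo 0 1) :
    consPNeg r a s ∈ Set.Ioo ((r : ℝ) / a) (r / ((a : ℝ) - 1)) := by
  have he := consPNeg_coeff_pos hr ha
  constructor
  · rw [consPNeg_eq hr ha]
    linarith [mul_pos he (sub_pos.2 hs.2)]
  · rw [consPNeg]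
    linarith [mul_pos he hs.1]

lemma consPNeg_mem_Ioc {r a : ℕ} (hr : 0 < r) (ha : r + 1 ≤ a) {s : ℝ} (hs : s ∈ Set.Icc 0 1) :
    consPNeg r a s ∈ Set.Ioc 0 1 := by
  have he := consPNeg_coeff_pos hr ha
  have ha0 : 0 < a := by omega
  constructor
  · rw [consPNeg_eq hr ha]
    have : (0 : ℝ) < r / a := by positivity
    linarith [mul_nonneg he.le (sub_nonneg.2 hs.2)]
  · rw [consPNeg]
    linarith [mul_nonneg he.le hs.1, div_sub_one_le_one hr ha]

lemma Ioo_div_subset {r a : ℕ} (hr : 0 < r) (ha : r + 1 ≤ a) :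
    Set.Ioo ((r : ℝ) / a) (r / ((a : ℝ) - 1)) ⊆ Set.Ioo 0 1 :=
  Set.Ioo_subset_Ioo (by positivity) (div_sub_one_le_one hr ha)

lemma consPNeg_inj {r a b : ℕ} (hr : 0 < r) (ha : r + 1 ≤ a) (hb : r + 1 ≤ b) {s t : ℝ}
    (hs : s ∈ Set.Ioo 0 1) (ht : t ∈ Set.Ioo 0 1) (h : consPNeg r a s = consPNeg r b t) :
    a = b ∧ s = t := by
  have hab : a = b := by
    wlog hlt : a < b generalizing a b s t
    · by_contra hne
      exact hne (this hb ha ht hs h.symm (by omega)).symm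
    have h1 := (consPNeg_mem_Ioo hr ha hs).1
    have h2 := (consPNeg_mem_Ioo hr hb ht).2
    have h3 : (a : ℝ) ≤ b - 1 := by
      have : (a : ℝ) + 1 ≤ b := by exact_mod_cast hlt
      linarith
    have ha0 : (0 : ℝ) < a := by exact_mod_cast (by omega : 0 < a)
    have h4 : (r : ℝ) / (b - 1) ≤ r / a := by gcongr
    linarith
  subst hab
  have he := consPNeg_coeff_pos hr ha
  refine ⟨rfl, mul_left_cancel₀ he.ne' ?_⟩
  rw [consPNeg, consPNeg] at h
  linarith

lemma abs_termPNeg_le (n : ℕ) : ∀ {φ : List ℕ → ℕ} {q : ℕ → ℕ}, (∀ l, 0 < φ l) →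
    PAdmissibleSeq φ q → |termPNeg φ q n| ≤ (1 / 2) ^ n := by
  induction n with
  | zero =>
    intro φ q hφ hq
    have h1 : (φ [] : ℝ) + 1 ≤ q 0 := by exact_mod_cast hq.first
    rw [termPNeg_zero, abs_of_nonneg (div_nonneg (by positivity)
      (by linarith [Nat.cast_nonneg (α := ℝ) (φ [])])), pow_zero]
    exact div_sub_one_le_one (hφ _) hq.first
  | succ n ih =>
    intro φ q hφ hq
    rw [termPNeg_succ, abs_mul, abs_neg, abs_of_pos (consPNeg_coeff_pos (hφ _) hq.first), pow_succ,
      mul_comm]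
    refine mul_le_mul (ih (fun _ => hφ _) hq.tail) ?_
      (consPNeg_coeff_pos (hφ _) hq.first).le (by positivity)
    have h0 : (1 : ℝ) ≤ φ [] := by exact_mod_cast hφ []
    have h1 : (φ [] : ℝ) + 1 ≤ q 0 := by exact_mod_cast hq.first
    have h2 : 0 < (q 0 : ℝ) - 1 := by linarith
    rw [← div_div]
    exact div_le_div₀ zero_le_one (div_sub_one_le_one (hφ _) hq.first) two_pos (by linarith)

lemma summable_termPNeg {φ : List ℕ → ℕ} {q : ℕ → ℕ} (hφ : ∀ l, 0 < φ l)
    (hq : PAdmissibleSeq φ q) : Summable (termPNeg φ q) :=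
  .of_norm_bounded summable_geometric_two fun n => abs_termPNeg_le n hφ hq

lemma valPNeg_eq_consPNeg {φ : List ℕ → ℕ} {q : ℕ → ℕ} (hφ : ∀ l, 0 < φ l)
    (hq : PAdmissibleSeq φ q) : valPNeg φ q = consPNeg (φ []) (q 0)
      (valPNeg (fun l => φ (q 0 :: l)) (fun i => q (i + 1))) := by
  change ∑' n, termPNeg φ q n = consPNeg _ _
    (∑' n, termPNeg (fun l => φ (q 0 :: l)) (fun i => q (i + 1)) n)
  rw [(summable_termPNeg hφ hq).tsum_eq_zero_add, termPNeg_zero]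
  simp only [termPNeg_succ, tsum_mul_left]
  rw [consPNeg]
  ring

lemma appendPNeg_mem_Icc (k : ℕ) : ∀ {φ : List ℕ → ℕ} {c : ℕ → ℕ} {t : ℝ}, (∀ l, 0 < φ l) →
    PAdmissibleTuple φ c k → t ∈ Set.Icc 0 1 → appendPNeg φ c k t ∈ Set.Icc 0 1 := by
  induction k with
  | zero =>
    intro φ c t _ _ ht
    rwa [appendPNeg_zero]
  | succ k ih =>
    intro φ c t hφ hc ht
    rw [appendPNeg_succ]
    exact Set.Ioc_subset_Icc_self
      (consPNeg_mem_Ioc (hφ _) hc.first (ih (fun _ => hφ _) hc.tail ht))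

lemma appendPNeg_mem_Ioo (k : ℕ) : ∀ {φ : List ℕ → ℕ} {c : ℕ → ℕ} {t : ℝ}, (∀ l, 0 < φ l) →
    PAdmissibleTuple φ c k → t ∈ Set.Ioo 0 1 → appendPNeg φ c k t ∈ Set.Ioo 0 1 := by
  induction k with
  | zero =>
    intro φ c t _ _ ht
    rwa [appendPNeg_zero]
  | succ k ih =>
    intro φ c t hφ hc ht
    rw [appendPNeg_succ]
    exact Ioo_div_subset (hφ _) hc.first
      (consPNeg_mem_Ioo (hφ _) hc.first (ih (fun _ => hφ _) hc.tail ht))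

lemma valPNeg_mem_Icc {φ : List ℕ → ℕ} {q : ℕ → ℕ} (hφ : ∀ l, 0 < φ l)
    (hq : PAdmissibleSeq φ q) : valPNeg φ q ∈ Set.Icc 0 1 := by
  refine isClosed_Icc.mem_of_tendsto (summable_termPNeg hφ hq).hasSum.tendsto_sum_nat
    (.of_forall fun n => ?_)
  have := appendPNeg_mem_Icc (t := 0) n hφ (fun i _ => hq i) (by simp)
  rwa [appendPNeg, mul_zero, add_zero] at this

lemma valPNeg_mem_Ioo_zero_one {φ : List ℕ → ℕ} {q : ℕ → ℕ} (hφ : ∀ l, 0 < φ l)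
    (hq : PAdmissibleSeq φ q) : valPNeg φ q ∈ Set.Ioo 0 1 := by
  have pos {φ : List ℕ → ℕ} {q : ℕ → ℕ} (hφ : ∀ l, 0 < φ l) (hq : PAdmissibleSeq φ q) :
      0 < valPNeg φ q := by
    rw [valPNeg_eq_consPNeg hφ hq]
    exact (consPNeg_mem_Ioc (hφ _) hq.first (valPNeg_mem_Icc (fun _ => hφ _) hq.tail)).1
  refine ⟨pos hφ hq, ?_⟩
  rw [valPNeg_eq_consPNeg hφ hq, consPNeg]
  linarith [mul_pos (consPNeg_coeff_pos (hφ _) hq.first) (pos (fun _ => hφ _) hq.tail),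
    div_sub_one_le_one (hφ _) hq.first]

lemma valPNeg_mem_Ioo {φ : List ℕ → ℕ} {q : ℕ → ℕ} (hφ : ∀ l, 0 < φ l)
    (hq : PAdmissibleSeq φ q) :
    valPNeg φ q ∈ Set.Ioo ((φ [] : ℝ) / q 0) (φ [] / ((q 0 : ℝ) - 1)) := by
  rw [valPNeg_eq_consPNeg hφ hq]
  exact consPNeg_mem_Ioo (hφ _) hq.first (valPNeg_mem_Ioo_zero_one (fun _ => hφ _) hq.tail)

lemma exists_valPNeg_eq_appendPNeg (k : ℕ) : ∀ {φ : List ℕ → ℕ} {c q : ℕ → ℕ}, (∀ l, 0 < φ l) →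
    PAdmissibleSeq φ q → (∀ i < k, q i = c i) →
    ∃ t ∈ Set.Ioo ((φ (prefixList c k) : ℝ) / q k) (φ (prefixList c k) / ((q k : ℝ) - 1)),
      valPNeg φ q = appendPNeg φ c k t := by
  induction k with
  | zero =>
    intro φ c q hφ hq _
    exact ⟨_, valPNeg_mem_Ioo hφ hq, (appendPNeg_zero _ _ _).symm⟩
  | succ k ih =>
    intro φ c q hφ hq hqc
    have h0 : q 0 = c 0 := hqc 0 k.succ_pos
    obtain ⟨t, ht, he⟩ := ih (c := fun i => c (i + 1)) (fun _ => hφ _) hq.tail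
      fun i hi => hqc (i + 1) (by omega)
    rw [h0] at he
    rw [h0, ← prefixList_succ] at ht
    refine ⟨t, ht, ?_⟩
    rw [valPNeg_eq_consPNeg hφ hq, appendPNeg_succ, h0, he]

lemma eq_of_valPNeg_eq_appendPNeg (k : ℕ) : ∀ {φ : List ℕ → ℕ} {c q : ℕ → ℕ} {t : ℝ},
    (∀ l, 0 < φ l) → PAdmissibleTuple φ c k → PAdmissibleSeq φ q → t ∈ Set.Ioo 0 1 →
    valPNeg φ q = appendPNeg φ c k t → ∀ i < k, q i = c i := by
  induction k with
  | zero =>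
    intro _ _ _ _ _ _ _ _ _ i hi
    omega
  | succ k ih =>
    intro φ c q t hφ hc hq ht he i hi
    rw [valPNeg_eq_consPNeg hφ hq, appendPNeg_succ] at he
    obtain ⟨h0, h1⟩ := consPNeg_inj (hφ _) hq.first hc.first
      (valPNeg_mem_Ioo_zero_one (fun _ => hφ _) hq.tail)
      (appendPNeg_mem_Ioo k (fun _ => hφ _) hc.tail ht) he
    cases i with
    | zero => exact h0
    | succ i =>
      have hq' := hq.tail
      rw [h0] at h1 hq'
      exact ih (fun _ => hφ _) hc.tail hq' ht h1 i (by omega)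

lemma DiamP_pos {φ : List ℕ → ℕ} {c : ℕ → ℕ} {k : ℕ} (hφ : ∀ l, 0 < φ l)
    (hc : PAdmissibleTuple φ c k) : 0 < DiamP φ c k := by
  refine div_pos (Finset.prod_pos fun i _ => by exact_mod_cast hφ _)
    (Finset.prod_pos fun i hi => ?_)
  have h1 : (φ (prefixList c i) : ℝ) + 1 ≤ c i := by exact_mod_cast hc i (Finset.mem_range.1 hi)
  have h0 : (0 : ℝ) < φ (prefixList c i) := by exact_mod_cast hφ _
  exact mul_pos (by linarith) (by linarith)

/-- convergence from the right to `x₀ = Inf^{P⁻}(c₁…c_k)`, `k` even. -/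
theorem stmt8 (φ : List ℕ → ℕ) (hφ : ∀ l, 0 < φ l)
    (k : ℕ) (hk : Even k) (hk0 : 0 < k)
    (c : ℕ → ℕ) (hc : PAdmissibleTuple φ c k)
    (d : ℕ → (ℕ → ℕ)) (hd : ∀ n, PAdmissibleSeq φ (d n))
    (hx : ∀ n, InfPNeg φ c k < valPNeg φ (d n) ∧ valPNeg φ (d n) < 1) :
    Filter.Tendsto (fun n => valPNeg φ (d n)) Filter.atTop (nhds (InfPNeg φ c k)) ↔
      ∃ n0 : ℕ, (∀ n ≥ n0, ∀ i < k, d n i = c i) ∧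
        Filter.Tendsto (fun n => d n k) Filter.atTop Filter.atTop := by
  have hD := DiamP_pos hφ hc
  have hInf : InfPNeg φ c k = APNeg φ c k := by simp [InfPNeg, Nat.not_odd_iff_even.2 hk]
  have happ (t : ℝ) : appendPNeg φ c k t = InfPNeg φ c k + DiamP φ c k * t := by
    rw [appendPNeg, hk.neg_one_pow, one_mul, hInf]
  set R : ℝ := (φ (prefixList c k) : ℝ)
  have hRpos : 0 < R := Nat.cast_pos.2 (hφ _)
  constructor
  · intro h
    set t : ℕ → ℝ := fun n => (valPNeg φ (d n) - InfPNeg φ c k) / DiamP φ c k with ht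
    have hval (n : ℕ) : valPNeg φ (d n) = appendPNeg φ c k (t n) := by
      rw [happ, ht]
      field_simp
      ring
    have ht_pos (n : ℕ) : 0 < t n := div_pos (sub_pos.2 (hx n).1) hD
    have ht_lim : Tendsto t atTop (𝓝 0) := by
      simpa using (h.sub_const (InfPNeg φ c k)).div_const (DiamP φ c k)
    obtain ⟨n0, hn0⟩ := eventually_atTop.1 (ht_lim.eventually_lt_const one_pos)
    have heq : ∀ n ≥ n0, ∀ i < k, d n i = c i := fun n hn =>
      eq_of_valPNeg_eq_appendPNeg k hφ hc (hd n) ⟨ht_pos n, hn0 n hn⟩ (hval n)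
    refine ⟨n0, heq, ?_⟩
    have hinv : Tendsto (fun n => R * (t n)⁻¹) atTop atTop :=
      (tendsto_inv_nhdsGT_zero.comp (tendsto_nhdsWithin_iff.2
        ⟨ht_lim, .of_forall ht_pos⟩)).const_mul_atTop hRpos
    refine tendsto_natCast_atTop_iff.1 (tendsto_atTop_mono' _ ?_ hinv)
    filter_upwards [eventually_ge_atTop n0] with n hn
    obtain ⟨s, hs, he⟩ := exists_valPNeg_eq_appendPNeg k hφ (hd n) (heq n hn)
    rw [hval, happ, happ] at he
    have hts : t n = s := mul_left_cancel₀ hD.ne' (add_left_cancel he)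
    have hpos : (0 : ℝ) < d n k := by exact_mod_cast (Nat.succ_pos _).trans_le (hd n k)
    rw [← div_eq_mul_inv, div_le_iff₀ (ht_pos n), hts, mul_comm]
    exact ((div_lt_iff₀ hpos).1 hs.1).le
  · rintro ⟨n0, heq, hlim⟩
    have hbound : Tendsto (fun n => InfPNeg φ c k + DiamP φ c k * (R / ((d n k : ℝ) - 1))) atTop
        (𝓝 (InfPNeg φ c k)) := by
      have h1 : Tendsto (fun n => (d n k : ℝ) - 1) atTop atTop :=
        tendsto_atTop_add_const_right _ (-1) (tendsto_natCast_atTop_atTop.comp hlim)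
      simpa using ((h1.const_div_atTop R).const_mul (DiamP φ c k)).const_add (InfPNeg φ c k)
    refine tendsto_of_tendsto_of_tendsto_of_le_of_le' tendsto_const_nhds hbound
      (.of_forall fun n => (hx n).1.le) ?_
    filter_upwards [eventually_ge_atTop n0] with n hn
    obtain ⟨s, hs, he⟩ := exists_valPNeg_eq_appendPNeg k hφ (hd n) (heq n hn)
    rw [he, happ]
    gcongr
    exact hs.2.le
end

section
/- Let (c_1,…,c_k) be a P-admissible finite tuple with k ≥ 1. Then the tuple (c_1,…,c_{k−1},c_k+1) is also P-admissible and Inf^P(c_1…c_k) = Sup^P(c_1…c_{k−1}(c_k+1)); that is, the infimum of any P-cylinder is the supremum of the neighboring left P-cylinder of the same rank. -/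
open Filter Finset Topology

theorem prefixList_congr {p q : ℕ → ℕ} {n : ℕ} (h : ∀ i < n, p i = q i) :
    prefixList p n = prefixList q n := by
  unfold prefixList
  congr 1
  funext i
  exact h i i.isLt

theorem numer_congr (φ : List ℕ → ℕ) {p q : ℕ → ℕ} {n : ℕ} (h : ∀ i < n, p i = q i) :
    numer φ p n = numer φ q n := by
  refine Finset.prod_congr rfl fun i hi => ?_
  rw [prefixList_congr fun j hj => h j (by grind)]

theorem denomBase_congr {p q : ℕ → ℕ} {n : ℕ} (h : ∀ i < n, p i = q i) :
    denomBase p n = denomBase q n := by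
  refine Finset.prod_congr rfl fun i hi => ?_
  rw [h i (Finset.mem_range.mp hi)]

theorem InfP_congr (φ : List ℕ → ℕ) {p q : ℕ → ℕ} {n : ℕ} (h : ∀ i < n, p i = q i) :
    InfP φ p n = InfP φ q n := by
  refine Finset.sum_congr rfl fun i hi => ?_
  have hi := Finset.mem_range.mp hi
  rw [h i hi, numer_congr φ fun j hj => h j (hj.trans hi),
    denomBase_congr fun j hj => h j (hj.trans hi)]

theorem InfP_succ (φ : List ℕ → ℕ) (c : ℕ → ℕ) (m : ℕ) :
    InfP φ c (m + 1) = InfP φ c m + numer φ c m / (denomBase c m * (c m : ℝ)) :=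
  Finset.sum_range_succ _ _

theorem DiamP_succ (φ : List ℕ → ℕ) (c : ℕ → ℕ) (m : ℕ) :
    DiamP φ c (m + 1) =
      numer φ c m / (denomBase c m * (((c m : ℝ) - 1) * (c m : ℝ))) := by
  simp only [DiamP, numer, denomBase, Finset.prod_range_succ _ m]

/-- the infimum of a `P`-cylinder is the supremum of the
neighbouring left `P`-cylinder of the same rank. -/
theorem stmt13 (φ : List ℕ → ℕ) (hφ : ∀ l, 0 < φ l)
    (k : ℕ) (hk : 0 < k) (c : ℕ → ℕ) (hc : PAdmissibleTuple φ c k) :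
    PAdmissibleTuple φ (Function.update c (k - 1) (c (k - 1) + 1)) k ∧
      InfP φ c k = SupP φ (Function.update c (k - 1) (c (k - 1) + 1)) k := by
  obtain ⟨m, rfl⟩ : ∃ m, k = m + 1 := ⟨k - 1, by omega⟩
  rw [Nat.add_sub_cancel]
  set d := Function.update c m (c m + 1) with hd
  have hlt : ∀ i < m, d i = c i := fun i hi => Function.update_of_ne hi.ne _ _
  have hm : d m = c m + 1 := Function.update_self _ _ _
  constructor
  · intro n hn
    have hcn := hc n hn
    rw [prefixList_congr fun i hi => hlt i (by omega)]
    rcases Nat.lt_succ_iff_lt_or_eq.mp hn with h | rfl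
    · rwa [hlt n h]
    · omega
  · have hpos : (0 : ℝ) < c m := by
      have := hc m (Nat.lt_succ_self m)
      exact_mod_cast (show 0 < c m by omega)
    have hpos' : (0 : ℝ) < (c m : ℝ) + 1 := by positivity
    have hfrac : (1 : ℝ) / c m = 1 / (c m + 1) + 1 / (c m * (c m + 1)) := by
      field_simp
    rw [SupP, InfP_succ, InfP_succ, DiamP_succ, InfP_congr φ hlt, numer_congr φ hlt,
      denomBase_congr hlt, hm, add_assoc]
    push_cast
    rw [add_sub_cancel_right, ← div_div, ← div_div, ← div_div,
      div_eq_mul_one_div _ (c m : ℝ), hfrac]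
    ring
end

section
/- Let p = (p_n)_{n≥1} be a P-admissible sequence. Then for every k ≥ 1, the finite tuple (p_1,…,p_k) is P-admissible and Inf^P(p_1…p_k) < val_P(p) ≤ Sup^P(p_1…p_k). -/
open Filter Finset Topology

section

variable {φ : List ℕ → ℕ} {p : ℕ → ℕ}

theorem PAdmissibleSeq.one_lt (hφ : ∀ l, 0 < φ l) (hp : PAdmissibleSeq φ p) (n : ℕ) :
    (1 : ℝ) < p n := by
  have h₁ := hp n
  have h₂ := hφ (prefixList p n)
  exact_mod_cast (by omega : 1 < p n)

theorem PAdmissibleSeq.denomBase_pos (hφ : ∀ l, 0 < φ l) (hp : PAdmissibleSeq φ p) (n : ℕ) :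
    0 < denomBase p n :=
  Finset.prod_pos fun j _ => by
    have h := hp.one_lt hφ j
    exact mul_pos (by linarith) (by linarith)

theorem PAdmissibleSeq.diamP_pos (hφ : ∀ l, 0 < φ l) (hp : PAdmissibleSeq φ p) (n : ℕ) :
    0 < DiamP φ p n :=
  div_pos (Finset.prod_pos fun _ _ => Nat.cast_pos.2 (hφ _)) (hp.denomBase_pos hφ n)

theorem numer_div_eq_diamP_mul (n : ℕ) :
    numer φ p n / (denomBase p n * (p n : ℝ)) =
      DiamP φ p n * ((φ (prefixList p n) : ℝ) / p n) := by
  rw [numer, Finset.prod_range_succ, DiamP, mul_div_mul_comm]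

theorem diamP_succ (n : ℕ) :
    DiamP φ p (n + 1) =
      DiamP φ p n * ((φ (prefixList p n) : ℝ) / (((p n : ℝ) - 1) * p n)) := by
  rw [DiamP, denomBase, Finset.prod_range_succ, Finset.prod_range_succ, mul_div_mul_comm]
  rfl

theorem PAdmissibleSeq.term_pos (hφ : ∀ l, 0 < φ l) (hp : PAdmissibleSeq φ p) (n : ℕ) :
    0 < numer φ p n / (denomBase p n * (p n : ℝ)) := by
  have h := hp.one_lt hφ n
  exact div_pos (Finset.prod_pos fun _ _ => Nat.cast_pos.2 (hφ _))
    (mul_pos (hp.denomBase_pos hφ n) (by linarith))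

/-- The suprema of the nested cylinders around an admissible sequence decrease. -/
theorem PAdmissibleSeq.antitone_supP (hφ : ∀ l, 0 < φ l) (hp : PAdmissibleSeq φ p) :
    Antitone (SupP φ p) := by
  refine antitone_nat_of_succ_le fun n => ?_
  have h₁ := hp.one_lt hφ n
  have h₂ : (φ (prefixList p n) : ℝ) + 1 ≤ p n := by exact_mod_cast hp n
  have h₃ : (0 : ℝ) < p n - 1 := by linarith
  have h₄ : (0 : ℝ) < p n := by linarith
  have key : (φ (prefixList p n) : ℝ) / p n
      + (φ (prefixList p n) : ℝ) / (((p n : ℝ) - 1) * p n) ≤ 1 := by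
    have : (φ (prefixList p n) : ℝ) / p n + (φ (prefixList p n) : ℝ) / (((p n : ℝ) - 1) * p n)
        = (φ (prefixList p n) : ℝ) / (p n - 1) := by
      field_simp
      ring
    rw [this, div_le_one h₃]
    linarith
  have h := mul_le_mul_of_nonneg_left key (hp.diamP_pos hφ n).le
  rw [SupP, SupP, InfP, InfP, Finset.sum_range_succ, numer_div_eq_diamP_mul, diamP_succ]
  linarith

theorem PAdmissibleSeq.infP_le_supP (hφ : ∀ l, 0 < φ l) (hp : PAdmissibleSeq φ p) (k n : ℕ) :
    InfP φ p n ≤ SupP φ p k := by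
  calc InfP φ p n ≤ InfP φ p (max k n) :=
        Finset.sum_le_sum_of_subset_of_nonneg (Finset.range_mono (le_max_right k n))
          fun i _ _ => (hp.term_pos hφ i).le
    _ ≤ SupP φ p (max k n) := le_add_of_nonneg_right (hp.diamP_pos hφ _).le
    _ ≤ SupP φ p k := hp.antitone_supP hφ (le_max_left k n)

theorem PAdmissibleSeq.summable (hφ : ∀ l, 0 < φ l) (hp : PAdmissibleSeq φ p) :
    Summable fun n => numer φ p n / (denomBase p n * (p n : ℝ)) :=
  summable_of_sum_range_le (fun n => (hp.term_pos hφ n).le) (hp.infP_le_supP hφ 0)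

end

/-- `Inf^P(p₁…p_k) < val_P(p) ≤ Sup^P(p₁…p_k)` for every `k ≥ 1`. -/
theorem stmt18 (φ : List ℕ → ℕ) (hφ : ∀ l, 0 < φ l)
    (p : ℕ → ℕ) (hp : PAdmissibleSeq φ p) :
    ∀ k : ℕ, 0 < k → PAdmissibleTuple φ p k ∧
      InfP φ p k < valP φ p ∧ valP φ p ≤ SupP φ p k := by
  intro k _
  refine ⟨fun n _ => hp n, ?_, ?_⟩
  · calc InfP φ p k < InfP φ p (k + 1) := by
          rw [InfP, InfP, Finset.sum_range_succ]
          exact lt_add_of_pos_right _ (hp.term_pos hφ k)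
      _ ≤ valP φ p :=
          (hp.summable hφ).sum_le_tsum _ fun i _ => (hp.term_pos hφ i).le
  · exact Real.tsum_le_of_sum_range_le (fun n => (hp.term_pos hφ n).le) (hp.infP_le_supP hφ k)
end
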